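/- arXiv:2511.00835 — 3 statements merged into one kernel-verified Lean document; each statement's English description precedes it below -/
import Mathlib

section
/- If χ and χ' are both stable allocations with profiles h and h' respectively, then the profiles are equivalent up to permutation: there exists a permutation σ of the agents with h'_i = h_{σ(i)} for every agent i. -/
open Finset

/-- `χ` is a (partial) allocation of `m` indivisible items to `n` agents respecting `likes`:
whenever item `o` is assigned to agent `j`, agent `j` likes item `o`. -/
def IsAlloc {m n : ℕ} (likes : Fin n → Fin m → Prop) (χ : Fin m → Option (Fin n)) : Prop :=
  ∀ o j, χ o = some j → likes j o

/-- The profile of an allocation: agent `j` receives `prof χ j` items. -/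
def prof {m n : ℕ} (χ : Fin m → Option (Fin n)) (j : Fin n) : ℕ :=
  (Finset.univ.filter fun o => χ o = some j).card

/-- Utilitarian social welfare: the total number of allocated items. -/
def usw {m n : ℕ} (χ : Fin m → Option (Fin n)) : ℕ := ∑ j, prof χ j

/-- A max-USW allocation. -/
def MaxUSW {m n : ℕ} (likes : Fin n → Fin m → Prop) (χ : Fin m → Option (Fin n)) : Prop :=
  IsAlloc likes χ ∧ ∀ χ', IsAlloc likes χ' → usw χ' ≤ usw χ

/-- A transfer path in `χ` from agent `u` to agent `v`: pairwise distinct agents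
`a 0 = u, …, a k = v` (`k ≥ 1`) and items `o 0, …, o (k-1)` with `χ` assigning `o t` to
`a t` and agent `a (t+1)` liking `o t`. -/
def TransferPath {m n : ℕ} (likes : Fin n → Fin m → Prop) (χ : Fin m → Option (Fin n))
    (u v : Fin n) : Prop :=
  ∃ k : ℕ, 1 ≤ k ∧ ∃ a : Fin (k + 1) → Fin n, Function.Injective a ∧
    a 0 = u ∧ a (Fin.last k) = v ∧
    ∃ o : Fin k → Fin m, ∀ t : Fin k,
      χ (o t) = some (a t.castSucc) ∧ likes (a t.succ) (o t)

/-- `χ` admits a narrowing transfer: a transfer path from `u` to `v` with `h_u ≥ h_v + 2`. -/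
def Narrowing {m n : ℕ} (likes : Fin n → Fin m → Prop) (χ : Fin m → Option (Fin n)) : Prop :=
  ∃ u v, TransferPath likes χ u v ∧ prof χ v + 2 ≤ prof χ u

/-- A stable allocation: max-USW and admitting no narrowing transfer. -/
def Stable {m n : ℕ} (likes : Fin n → Fin m → Prop) (χ : Fin m → Option (Fin n)) : Prop :=
  MaxUSW likes χ ∧ ¬ Narrowing likes χ

/-- The profile of `χ` sorted in ascending order. -/
noncomputable def sortedProf {m n : ℕ} (χ : Fin m → Option (Fin n)) : Fin n → ℕ :=
  prof χ ∘ Tuple.sort (prof χ)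

/-- Any agent who likes an item held by the endpoint of a transfer path from `u` is `u` itself or
the endpoint of a transfer path from `u`. -/
theorem TransferPath.extend {m n : ℕ} {likes : Fin n → Fin m → Prop} {χ : Fin m → Option (Fin n)}
    {u v w : Fin n} {x : Fin m} (h : u = v ∨ TransferPath likes χ u v)
    (hx : χ x = some v) (hw : likes w x) : u = w ∨ TransferPath likes χ u w := by
  obtain ⟨k, a, ha, h0, hk, o, ho⟩ : ∃ k : ℕ, ∃ a : Fin (k + 1) → Fin n, Function.Injective a ∧
      a 0 = u ∧ a (Fin.last k) = v ∧ ∃ o : Fin k → Fin m, ∀ t : Fin k,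
        χ (o t) = some (a t.castSucc) ∧ likes (a t.succ) (o t) := by
    rcases h with rfl | ⟨k, -, h⟩
    · exact ⟨0, fun _ => u, fun _ _ _ => Subsingleton.elim (α := Fin 1) _ _, rfl, rfl,
        Fin.elim0, fun t => t.elim0⟩
    · exact ⟨k, h⟩
  by_cases hr : w ∈ Set.range a
  · obtain ⟨i, rfl⟩ := hr
    rcases Nat.eq_zero_or_pos i.val with hi | hi
    · left
      rw [← h0]
      congr 1
      exact (Fin.ext hi).symm
    · right
      refine ⟨i, hi, fun t => a (Fin.castLE (by omega) t), ?_, ?_, ?_,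
        fun t => o (Fin.castLE (by omega) t), fun t => ho (Fin.castLE (by omega) t)⟩
      · exact ha.comp (Fin.castLE_injective _)
      · exact h0
      · rfl
  · right
    refine ⟨k + 1, by omega, Fin.snoc (α := fun _ => Fin n) a w, ?_, ?_, Fin.snoc_last _ _,
      Fin.snoc (α := fun _ => Fin m) o x, ?_⟩
    · exact Fin.snoc_injective_iff.2 ⟨ha, hr⟩
    · rw [← Fin.castSucc_zero, Fin.snoc_castSucc (α := fun _ => Fin n), h0]
    · intro t
      refine Fin.lastCases ?_ (fun t => ?_) t
      · rw [Fin.snoc_last, Fin.snoc_castSucc (α := fun _ => Fin n), Fin.succ_last, Fin.snoc_last]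
        exact ⟨by rw [hx, hk], hw⟩
      · rw [Fin.snoc_castSucc (α := fun _ => Fin m), Fin.snoc_castSucc (α := fun _ => Fin n),
          Fin.succ_castSucc, Fin.snoc_castSucc (α := fun _ => Fin n)]
        exact ho t

/-- The agents of `S` jointly hold the items assigned to a member of `S`. -/
theorem sum_prof_eq_card {m n : ℕ} (χ : Fin m → Option (Fin n)) (S : Finset (Fin n)) :
    ∑ j ∈ S, prof χ j = (univ.filter fun o => ∃ j ∈ S, χ o = some j).card := by
  unfold prof
  rw [← card_biUnion]
  · congr 1
    ext o
    simp
  · intro i _ j _ hij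
    refine disjoint_left.2 fun o hi hj => hij ?_
    simp only [mem_filter] at hi hj
    exact Option.some.inj (hi.2.symm.trans hj.2)

/-- A max-USW allocation leaves no liked item unallocated. -/
theorem MaxUSW.exists_eq_some {m n : ℕ} {likes : Fin n → Fin m → Prop}
    {χ : Fin m → Option (Fin n)} (h : MaxUSW likes χ) {j : Fin n} {o : Fin m}
    (hj : likes j o) : ∃ i, χ o = some i := by
  by_contra! hno
  have hle := h.2 (Function.update χ o (some j)) (by
    intro p i hp
    by_cases hpo : p = o
    · subst hpo
      simp only [Function.update_self, Option.some.injEq] at hp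
      exact hp ▸ hj
    · rw [Function.update_of_ne hpo] at hp
      exact h.1 p i hp)
  unfold usw at hle
  rw [sum_prof_eq_card, sum_prof_eq_card] at hle
  refine absurd hle (not_le.2 (card_lt_card ?_))
  refine (ssubset_iff_of_subset fun p hp => ?_).2 ⟨o, by simp, by simp [hno]⟩
  simp only [mem_filter, mem_univ, true_and] at hp ⊢
  obtain ⟨i, hi⟩ := hp
  refine ⟨i, ?_⟩
  rwa [Function.update_of_ne]
  rintro rfl
  exact hno i hi

/-- A stable allocation minimizes, for each `c`, the total excess over `c` among the max-USW
allocations. -/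
theorem Stable.sum_excess_le {m n : ℕ} {likes : Fin n → Fin m → Prop}
    {χ χ' : Fin m → Option (Fin n)} (h : Stable likes χ) (h' : MaxUSW likes χ') (c : ℕ) :
    ∑ j, (prof χ j - c) ≤ ∑ j, (prof χ' j - c) := by
  classical
  let S : Finset (Fin n) :=
    univ.filter fun v => ∃ u, c + 1 ≤ prof χ u ∧ (u = v ∨ TransferPath likes χ u v)
  have hS : ∀ v ∈ S, c ≤ prof χ v := by
    intro v hv
    obtain ⟨u, hu, rfl | hp⟩ := (mem_filter.1 hv).2
    · omega
    · by_contra hlt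
      exact h.2 ⟨u, v, hp, by omega⟩
  have hheld : ∑ j ∈ S, prof χ j ≤ ∑ j ∈ S, prof χ' j := by
    rw [sum_prof_eq_card, sum_prof_eq_card]
    refine card_le_card fun o ho => ?_
    simp only [mem_filter, mem_univ, true_and] at ho ⊢
    obtain ⟨j, hj, hjo⟩ := ho
    obtain ⟨i, hi⟩ := h'.exists_eq_some (h.1.1 o j hjo)
    obtain ⟨u, hu, hp⟩ := (mem_filter.1 hj).2
    exact ⟨i, mem_filter.2 ⟨mem_univ _, u, hu, TransferPath.extend hp hjo (h'.1 o i hi)⟩, hi⟩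
  have hχ : ∑ j, (prof χ j - c) = ∑ j ∈ S, (prof χ j - c) := by
    refine (sum_subset (subset_univ S) fun j _ hj => ?_).symm
    by_contra hne
    exact hj (mem_filter.2 ⟨mem_univ _, j, by omega, Or.inl rfl⟩)
  have h₁ : ∑ j ∈ S, (prof χ j - c) + ∑ _j ∈ S, c = ∑ j ∈ S, prof χ j := by
    rw [← sum_add_distrib]
    exact sum_congr rfl fun j hj => Nat.sub_add_cancel (hS j hj)
  have h₂ : ∑ j ∈ S, prof χ' j ≤ ∑ j ∈ S, (prof χ' j - c) + ∑ _j ∈ S, c := by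
    rw [← sum_add_distrib]
    exact sum_le_sum fun j _ => le_tsub_add
  have h₃ : ∑ j ∈ S, (prof χ' j - c) ≤ ∑ j, (prof χ' j - c) :=
    sum_le_sum_of_subset (subset_univ S)
  omega

/-- The total excesses of a function over all thresholds determine its fibre sizes. -/
theorem card_fiber_eq_of_sum_excess_eq {ι : Type*} [Fintype ι] {f g : ι → ℕ}
    (h : ∀ c, ∑ j, (f j - c) = ∑ j, (g j - c)) (c : ℕ) :
    (univ.filter fun j => f j = c).card = (univ.filter fun j => g j = c).card := by
  cases c with
  | zero =>
    have key (f : ι → ℕ) : (univ.filter fun j => f j = 0).card + ∑ j, (f j - 0)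
        = ∑ _j : ι, 1 + ∑ j, (f j - 1) := by
      rw [card_filter, ← sum_add_distrib, ← sum_add_distrib]
      refine sum_congr rfl fun j _ => ?_
      split_ifs <;> omega
    have hf := key f
    have hg := key g
    have h0 := h 0
    have h1 := h 1
    omega
  | succ c =>
    have key (f : ι → ℕ) : (univ.filter fun j => f j = c + 1).card
        + (∑ j, (f j - (c + 1)) + ∑ j, (f j - (c + 1)))
        = ∑ j, (f j - c) + ∑ j, (f j - (c + 2)) := by
      rw [card_filter, ← sum_add_distrib, ← sum_add_distrib, ← sum_add_distrib]
      refine sum_congr rfl fun j _ => ?_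
      split_ifs <;> omega
    have hf := key f
    have hg := key g
    have h0 := h c
    have h1 := h (c + 1)
    have h2 := h (c + 2)
    omega

/-- the profiles of any two stable allocations are equivalent up to
permutation of the agents. -/
theorem stable_profiles_perm_equiv {m n : ℕ} (likes : Fin n → Fin m → Prop)
    (χ χ' : Fin m → Option (Fin n)) (hχ : Stable likes χ) (hχ' : Stable likes χ') :
    ∃ σ : Equiv.Perm (Fin n), ∀ i, prof χ' i = prof χ (σ i) := by
  have hfib := card_fiber_eq_of_sum_excess_eq fun c =>
    (hχ'.sum_excess_le hχ.1 c).antisymm (hχ.sum_excess_le hχ'.1 c)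
  let e (c : ℕ) : {j // prof χ' j = c} ≃ {j // prof χ j = c} :=
    Fintype.equivOfCardEq (by rw [Fintype.card_subtype, Fintype.card_subtype, hfib c])
  exact ⟨Equiv.ofFiberEquiv e, fun i => (Equiv.ofFiberEquiv_map e i).symm⟩
end

section
/- Fix a stable allocation χ and define the sets p_d, q_d, r_d, s_d of agents from χ as in the context. Then: (1) for every agent i ∈ r_d, every stable allocation assigns exactly d items to i; (2) for every agent i ∈ s_d, every stable allocation assigns either d or d − 1 items to i, and moreover there exists a stable allocation assigning exactly d items to i and a stable allocation assigning exactly d − 1 items to i. -/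
open Finset

/-- `pset likes χ d`: agents `i` with `h_i = d` admitting a transfer path in `χ` from `i`
to some agent `j` with `h_j = d - 1`. -/
def pset {m n : ℕ} (likes : Fin n → Fin m → Prop) (χ : Fin m → Option (Fin n)) (d : ℕ) :
    Set (Fin n) :=
  {i | prof χ i = d ∧ ∃ j, TransferPath likes χ i j ∧ prof χ j + 1 = d}

/-- `qset likes χ d`: agents `i` with `h_i = d` admitting a transfer path in `χ` from some
agent `k` with `h_k = d + 1` to `i`. -/
def qset {m n : ℕ} (likes : Fin n → Fin m → Prop) (χ : Fin m → Option (Fin n)) (d : ℕ) :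
    Set (Fin n) :=
  {i | prof χ i = d ∧ ∃ k, TransferPath likes χ k i ∧ prof χ k = d + 1}

/-- `rset likes χ d`: agents `i` with `h_i = d` belonging to neither `pset` nor `qset`. -/
def rset {m n : ℕ} (likes : Fin n → Fin m → Prop) (χ : Fin m → Option (Fin n)) (d : ℕ) :
    Set (Fin n) :=
  {i | prof χ i = d ∧ i ∉ pset likes χ d ∧ i ∉ qset likes χ d}

/-- `sset likes χ d = pset d ∪ qset (d-1)` (meaningful for `d ≥ 1`). -/
def sset {m n : ℕ} (likes : Fin n → Fin m → Prop) (χ : Fin m → Option (Fin n)) (d : ℕ) :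
    Set (Fin n) :=
  pset likes χ d ∪ qset likes χ (d - 1)

section

variable {m n : ℕ} {likes : Fin n → Fin m → Prop} {χ χ' : Fin m → Option (Fin n)} {u v : Fin n}

lemma prof_eq_sum (χ : Fin m → Option (Fin n)) (j : Fin n) :
    prof χ j = ∑ o, if χ o = some j then 1 else 0 := by
  simp [prof]

/-- The one-step transfer relation: `b` likes an item that `χ` assigns to `a`. -/
def Envies (likes : Fin n → Fin m → Prop) (χ : Fin m → Option (Fin n)) (a b : Fin n) : Prop :=
  ∃ o, χ o = some a ∧ likes b o

lemma exists_injOn_walk {α : Type*} {r : α → α → Prop} {x y : α}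
    (h : Relation.ReflTransGen r x y) :
    ∃ (k : ℕ) (a : ℕ → α), Set.InjOn a (Set.Iic k) ∧ a 0 = x ∧ a k = y ∧
      ∀ t < k, r (a t) (a (t + 1)) := by
  induction h using Relation.ReflTransGen.head_induction_on with
  | refl => exact ⟨0, fun _ => y, by simp [Set.InjOn], rfl, rfl, by simp⟩
  | @head x z hxz _ ih =>
    obtain ⟨k, a, hinj, h0, hk, hr⟩ := ih
    by_cases hx : ∃ t ≤ k, a t = x
    · obtain ⟨t, ht, hat⟩ := hx
      refine ⟨k - t, fun s => a (s + t), ?_, by simpa using hat, ?_, ?_⟩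
      · intro s hs s' hs' hss
        simp only [Set.mem_Iic] at hs hs'
        have := hinj (Set.mem_Iic.2 (by omega)) (Set.mem_Iic.2 (by omega)) hss
        omega
      · simpa [Nat.sub_add_cancel ht] using hk
      · intro s hs
        have := hr (s + t) (by omega)
        rwa [show s + t + 1 = s + 1 + t by omega] at this
    · push Not at hx
      refine ⟨k + 1, fun s => Nat.casesOn s x a, ?_, rfl, hk, ?_⟩
      · rintro (_ | s) hs (_ | s') hs' hss
        · rfl
        · exact absurd hss.symm (hx s' (by simpa using hs'))
        · exact absurd hss (hx s (by simpa using hs))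
        · have := hinj (by simpa using hs) (by simpa using hs') hss
          omega
      · rintro (_ | s) hs
        · simpa [h0] using hxz
        · exact hr s (by omega)

lemma TransferPath.of_reflTransGen (huv : u ≠ v)
    (h : Relation.ReflTransGen (Envies likes χ) u v) : TransferPath likes χ u v := by
  obtain ⟨k, a, hinj, h0, hk, hr⟩ := exists_injOn_walk h
  refine ⟨k, ?_, fun t => a t, ?_, by simpa using h0, by simpa using hk, ?_⟩
  · rcases k with _ | k
    · exact absurd (h0.symm.trans hk) huv
    · omega
  · intro s t hst
    exact Fin.ext (hinj (Set.mem_Iic.2 s.is_le) (Set.mem_Iic.2 t.is_le) hst)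
  · choose o ho using fun t : Fin k => hr t t.2
    exact ⟨o, fun t => by simpa using ho t⟩

lemma TransferPath.reflTransGen (h : TransferPath likes χ u v) :
    Relation.ReflTransGen (Envies likes χ) u v := by
  obtain ⟨k, -, a, -, rfl, rfl, o, ho⟩ := h
  suffices ∀ t : Fin (k + 1), Relation.ReflTransGen (Envies likes χ) (a 0) (a t) from this _
  intro t
  induction t using Fin.induction with
  | zero => exact .refl
  | succ t ih => exact ih.tail ⟨o t, ho t⟩

lemma TransferPath.ne (h : TransferPath likes χ u v) : u ≠ v := by
  obtain ⟨k, hk, a, ha, rfl, rfl, -⟩ := h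
  intro h0
  have := congrArg Fin.val (ha h0)
  simp at this
  omega

/-- Passing items along a transfer path moves one unit of income from its start to its end. -/
lemma TransferPath.exists_alloc (hχ : IsAlloc likes χ) (h : TransferPath likes χ u v) :
    ∃ χ', IsAlloc likes χ' ∧ ∀ j, (prof χ' j : ℤ) =
      prof χ j + (if v = j then 1 else 0) - (if u = j then 1 else 0) := by
  obtain ⟨k, -, a, ha, rfl, rfl, o, ho⟩ := h
  have hinj : Function.Injective o := fun s t hst => by
    have := (ho s).1
    rw [hst, (ho t).1, Option.some_inj] at this
    exact (Fin.castSucc_injective _ (ha this)).symm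
  refine ⟨Function.extend o (fun t => some (a t.succ)) χ, ?_, fun j => ?_⟩
  · intro x j hx
    by_cases hr : ∃ t, o t = x
    · obtain ⟨t, rfl⟩ := hr
      rw [hinj.extend_apply, Option.some_inj] at hx
      exact hx ▸ (ho t).2
    · rw [Function.extend_apply' _ _ _ hr] at hx
      exact hχ x j hx
  · have hsum : ∑ t : Fin k,
        ((if a t.succ = j then 1 else 0) - (if a t.castSucc = j then 1 else 0) : ℤ) =
        ∑ x, ((if Function.extend o (fun t => some (a t.succ)) χ x = some j then 1 else 0) -
          (if χ x = some j then 1 else 0)) := by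
      refine Fintype.sum_of_injective o hinj _ _ ?_ ?_
      · intro x hx
        rw [Function.extend_apply' _ _ _ hx, sub_self]
      · intro t
        simp only [hinj.extend_apply, (ho t).1, Option.some_inj]
    have h1 := Fin.sum_univ_succ (fun t : Fin (k + 1) => if a t = j then (1 : ℤ) else 0)
    have h2 := Fin.sum_univ_castSucc (fun t : Fin (k + 1) => if a t = j then (1 : ℤ) else 0)
    rw [Finset.sum_sub_distrib, Finset.sum_sub_distrib] at hsum
    simp only [prof_eq_sum, Nat.cast_sum, Nat.cast_ite, Nat.cast_one, Nat.cast_zero]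
    linarith

/-- The effect of moving one unit of income from `u` to `v` on a separable sum of the profile. -/
lemma sum_transfer {ι : Type*} [Fintype ι] [DecidableEq ι] {u v : ι} (huv : u ≠ v)
    (h h' : ι → ℤ) (g : ι → ℤ → ℤ)
    (hh : ∀ j, h' j = h j + (if v = j then 1 else 0) - (if u = j then 1 else 0)) :
    ∑ j, g j (h' j) = ∑ j, g j (h j) + (g v (h v + 1) - g v (h v))
      + (g u (h u - 1) - g u (h u)) := by
  have key : ∀ j, g j (h' j) = g j (h j) + (if v = j then g v (h v + 1) - g v (h v) else 0)
      + (if u = j then g u (h u - 1) - g u (h u) else 0) := by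
    intro j
    rw [hh]
    split_ifs with hv hu hu
    · exact absurd (hu.trans hv.symm) huv
    · subst hv; simp
    · subst hu; simp
    · simp
  simp [key, Finset.sum_add_distrib]

/-- The sum of squares of the profile. -/
def sqSum (χ : Fin m → Option (Fin n)) : ℤ := ∑ j, (prof χ j : ℤ) ^ 2

lemma TransferPath.exists_maxUSW (hχ : MaxUSW likes χ) (h : TransferPath likes χ u v) :
    ∃ χ', MaxUSW likes χ' ∧
      (∀ j, (prof χ' j : ℤ) =
        prof χ j + (if v = j then 1 else 0) - (if u = j then 1 else 0)) ∧
      sqSum χ' = sqSum χ + 2 * (prof χ v + 1 - prof χ u) := by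
  obtain ⟨χ', hal, hp⟩ := h.exists_alloc hχ.1
  refine ⟨χ', ⟨hal, fun χ'' h'' => ?_⟩, hp, ?_⟩
  · have : (usw χ' : ℤ) = usw χ := by
      simp [usw, hp, Finset.sum_add_distrib]
    have := hχ.2 χ'' h''
    omega
  · have := sum_transfer h.ne (fun j => (prof χ j : ℤ)) (fun j => prof χ' j) (fun _ x => x ^ 2) hp
    simp only [sqSum, this]
    ring

lemma MaxUSW.exists_eq_some_s6 (hχ : IsAlloc likes χ) (hχ' : MaxUSW likes χ') {o : Fin m}
    {a : Fin n} (ho : χ o = some a) : ∃ b, χ' o = some b := by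
  by_contra! hne
  have hnone : χ' o = none := Option.eq_none_iff_forall_ne_some.2 hne
  have hle : usw (Function.update χ' o (some a)) ≤ usw χ' := by
    refine hχ'.2 _ fun x j hx => ?_
    by_cases hxo : x = o
    · subst hxo
      rw [Function.update_self, Option.some_inj] at hx
      exact hx ▸ hχ _ _ ho
    · rw [Function.update_of_ne hxo] at hx
      exact hχ'.1 x j hx
  have hsub : ∀ j, (univ.filter fun x => χ' x = some j) ⊆
      univ.filter fun x => Function.update χ' o (some a) x = some j := by
    intro j x hx
    simp only [mem_filter, mem_univ, true_and] at hx ⊢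
    rwa [Function.update_of_ne]
    rintro rfl
    simp [hnone] at hx
  refine absurd hle (not_le.2 (Finset.sum_lt_sum (fun j _ => card_le_card (hsub j))
    ⟨a, mem_univ _, card_lt_card ((hsub a).ssubset_of_not_subset fun hs => ?_)⟩))
  have : o ∈ univ.filter fun x => χ' x = some a := hs (by simp)
  simp [hnone] at this

/-- Simultaneous exchange between two max-USW allocations. -/
lemma MaxUSW.exists_exchange (hχ : MaxUSW likes χ) (hχ' : MaxUSW likes χ') {i : Fin n}
    (hi : prof χ' i < prof χ i) :
    ∃ j, prof χ j < prof χ' j ∧ TransferPath likes χ i j ∧ TransferPath likes χ' j i := by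
  classical
  let D : Fin n → Fin n → Prop := fun a b => ∃ o, χ o = some a ∧ χ' o = some b
  let R : Finset (Fin n) := univ.filter fun j => Relation.ReflTransGen D i j
  have hle : ∑ j ∈ R, prof χ j ≤ ∑ j ∈ R, prof χ' j := by
    simp only [prof_eq_sum]
    rw [Finset.sum_comm, Finset.sum_comm (s := R)]
    refine Finset.sum_le_sum fun o _ => ?_
    rcases ho : χ o with _ | a
    · simp
    · obtain ⟨b, hb⟩ := hχ'.exists_eq_some_s6 hχ.1 ho
      have hab : a ∈ R → b ∈ R := fun ha => by
        simp only [R, mem_filter, mem_univ, true_and] at ha ⊢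
        exact ha.tail ⟨o, ho, hb⟩
      simp only [hb, Option.some_inj, Finset.sum_ite_eq]
      split_ifs <;> simp_all
  obtain ⟨j, hjR, hj⟩ : ∃ j ∈ R, prof χ j < prof χ' j := by
    by_contra! hge
    exact absurd hle (not_le.2 (Finset.sum_lt_sum hge
      ⟨i, by simp [R, Relation.ReflTransGen.refl], hi⟩))
  have hij : i ≠ j := by rintro rfl; omega
  have hD : Relation.ReflTransGen D i j := by simpa [R] using hjR
  refine ⟨j, hj, .of_reflTransGen hij (Relation.ReflTransGen.mono ?_ _ _ hD), .of_reflTransGen hij.symm ?_⟩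
  · rintro a b ⟨o, ha, hb⟩
    exact ⟨o, ha, hχ'.1 _ _ hb⟩
  · refine Relation.ReflTransGen.mono ?_ _ _ (Relation.ReflTransGen.swap _ _ hD)
    rintro b a ⟨o, ha, hb⟩
    exact ⟨o, hb, hχ.1 _ _ ha⟩

lemma Stable.prof_le (hχ : Stable likes χ) (h : TransferPath likes χ u v) :
    prof χ u ≤ prof χ v + 1 := by
  by_contra! hlt
  exact hχ.2 ⟨u, v, h, hlt⟩

lemma Stable.sqSum_le (hχ : Stable likes χ) (hχ' : MaxUSW likes χ') : sqSum χ ≤ sqSum χ' := by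
  obtain ⟨N, hN⟩ : ∃ N : ℕ, ∑ j, ((prof χ j : ℤ) - prof χ' j) ^ 2 < N :=
    ⟨(∑ j, ((prof χ j : ℤ) - prof χ' j) ^ 2).toNat + 1, by omega⟩
  induction N generalizing χ' with
  | zero => exact absurd hN (not_lt.2 (by simpa using Finset.sum_nonneg fun j _ => sq_nonneg _))
  | succ N ih =>
    by_cases hne : ∃ i, prof χ' i < prof χ i
    · obtain ⟨i, hi⟩ := hne
      obtain ⟨j, hj, hij, hji⟩ := hχ.1.exists_exchange hχ' hi
      have hst := hχ.prof_le hij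
      obtain ⟨χ'', hmax, hp, hsq⟩ := hji.exists_maxUSW hχ'
      have hd := sum_transfer hji.ne (fun j => (prof χ' j : ℤ)) (fun j => prof χ'' j)
        (fun j x => (prof χ j - x) ^ 2) hp
      have h1 : sqSum χ ≤ sqSum χ'' := by
        refine ih hmax ?_
        push_cast at hN
        nlinarith
      omega
    · push Not at hne
      exact Finset.sum_le_sum fun j _ => by
        have := hne j
        gcongr

lemma MaxUSW.stable_of_sqSum_le (hχ : MaxUSW likes χ)
    (h : ∀ χ', MaxUSW likes χ' → sqSum χ ≤ sqSum χ') : Stable likes χ := by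
  refine ⟨hχ, ?_⟩
  rintro ⟨u, v, huv, hlt⟩
  obtain ⟨χ', hmax, -, hsq⟩ := huv.exists_maxUSW hχ
  have := h χ' hmax
  omega

lemma Stable.exists_transfer (hχ : Stable likes χ) (h : TransferPath likes χ u v)
    (huv : prof χ u = prof χ v + 1) :
    ∃ χ', Stable likes χ' ∧ prof χ' u = prof χ v ∧ prof χ' v = prof χ u := by
  obtain ⟨χ', hmax, hp, hsq⟩ := h.exists_maxUSW hχ.1
  refine ⟨χ', hmax.stable_of_sqSum_le fun χ'' h'' => ?_, ?_, ?_⟩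
  · have := hχ.sqSum_le h''
    omega
  · have := hp u
    simp only [h.ne.symm, if_true, if_false] at this
    omega
  · have := hp v
    simp only [h.ne, if_true, if_false] at this
    omega

lemma Stable.mem_pset_of_prof_lt (hχ : Stable likes χ) (hχ' : Stable likes χ') {i : Fin n}
    (hi : prof χ' i < prof χ i) : prof χ' i + 1 = prof χ i ∧ i ∈ pset likes χ (prof χ i) := by
  obtain ⟨j, hj, hij, hji⟩ := hχ.1.exists_exchange hχ'.1 hi
  have h1 := hχ.prof_le hij
  have h2 := hχ'.prof_le hji
  exact ⟨by omega, rfl, j, hij, by omega⟩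

lemma Stable.mem_qset_of_lt_prof (hχ : Stable likes χ) (hχ' : Stable likes χ') {i : Fin n}
    (hi : prof χ i < prof χ' i) : prof χ' i = prof χ i + 1 ∧ i ∈ qset likes χ (prof χ i) := by
  obtain ⟨j, hj, hij, hji⟩ := hχ'.1.exists_exchange hχ.1 hi
  have h1 := hχ'.prof_le hij
  have h2 := hχ.prof_le hji
  exact ⟨by omega, rfl, j, hji, by omega⟩

lemma Stable.disjoint_pset_qset (hχ : Stable likes χ) (d : ℕ) :
    Disjoint (pset likes χ d) (qset likes χ d) := by
  refine Set.disjoint_left.2 ?_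
  rintro i ⟨-, j, hij, hj⟩ ⟨-, k, hki, hk⟩
  have hkj : k ≠ j := by rintro rfl; omega
  have := hχ.prof_le (.of_reflTransGen hkj (hki.reflTransGen.trans hij.reflTransGen))
  omega

end

/-- fix a stable allocation `χ` and define `r_d, s_d` from `χ`.  Then
(1) every stable allocation assigns exactly `d` items to each agent of `r_d`;
(2) for `d ≥ 1`, every stable allocation assigns `d` or `d - 1` items to each agent of
`s_d`, and both values are attained by some stable allocations. -/
theorem layer_agents_incomes {m n : ℕ} (likes : Fin n → Fin m → Prop)
    (χ : Fin m → Option (Fin n)) (hχ : Stable likes χ) (d : ℕ) :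
    (∀ i ∈ rset likes χ d, ∀ χ', Stable likes χ' → prof χ' i = d) ∧
    (1 ≤ d → ∀ i ∈ sset likes χ d,
      (∀ χ', Stable likes χ' → prof χ' i = d ∨ prof χ' i + 1 = d) ∧
      (∃ χ', Stable likes χ' ∧ prof χ' i = d) ∧
      (∃ χ', Stable likes χ' ∧ prof χ' i + 1 = d)) := by
  refine ⟨?_, fun hd i hi => ?_⟩
  · rintro i ⟨rfl, hp, hq⟩ χ' hχ'
    rcases lt_trichotomy (prof χ' i) (prof χ i) with h | h | h
    · exact absurd (hχ.mem_pset_of_prof_lt hχ' h).2 hp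
    · exact h
    · exact absurd (hχ.mem_qset_of_lt_prof hχ' h).2 hq
  · rcases hi with hp | hq
    · obtain ⟨rfl, j, hij, hj⟩ := id hp
      refine ⟨fun χ' hχ' => ?_, ⟨χ, hχ, rfl⟩, ?_⟩
      · rcases lt_trichotomy (prof χ' i) (prof χ i) with h | h | h
        · exact .inr (hχ.mem_pset_of_prof_lt hχ' h).1
        · exact .inl h
        · exact absurd (hχ.mem_qset_of_lt_prof hχ' h).2
            (Set.disjoint_left.1 (hχ.disjoint_pset_qset _) hp)
      · obtain ⟨χ', hst, hu, -⟩ := hχ.exists_transfer hij hj.symm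
        exact ⟨χ', hst, by omega⟩
    · obtain ⟨hid, k, hki, hk⟩ := id hq
      refine ⟨fun χ' hχ' => ?_, ?_, ⟨χ, hχ, by omega⟩⟩
      · rcases lt_trichotomy (prof χ' i) (prof χ i) with h | h | h
        · have := (hχ.mem_pset_of_prof_lt hχ' h).2
          rw [hid] at this
          exact absurd hq (Set.disjoint_left.1 (hχ.disjoint_pset_qset _) this)
        · exact .inr (by omega)
        · have := (hχ.mem_qset_of_lt_prof hχ' h).1
          exact .inl (by omega)
      · obtain ⟨χ', hst, -, hv⟩ := hχ.exists_transfer hki (by omega)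
        exact ⟨χ', hst, by omega⟩
end

section
/- Let x and x' be stable divisible allocations with profiles h and h' respectively. Then h_i = h'_i for every agent i; in other words, the profiles of any two stable divisible allocations are identical (their Chebyshev distance is 0). -/
open Finset

/-- `x` is a divisible allocation of `m` divisible items to `n` agents respecting `likes`:
fractions are nonnegative, zero on disliked items, and each item is allocated to total
extent at most `1`. -/
def IsDAlloc {m n : ℕ} (likes : Fin n → Fin m → Prop) (x : Fin m → Fin n → ℝ) : Prop :=
  (∀ o j, 0 ≤ x o j) ∧ (∀ o j, ¬ likes j o → x o j = 0) ∧ (∀ o, ∑ j, x o j ≤ 1)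

/-- The profile of a divisible allocation: agent `j` receives total amount `dprof x j`. -/
def dprof {m n : ℕ} (x : Fin m → Fin n → ℝ) (j : Fin n) : ℝ := ∑ o, x o j

/-- A max-USW divisible allocation: the total allocated amount is maximal. -/
def DMaxUSW {m n : ℕ} (likes : Fin n → Fin m → Prop) (x : Fin m → Fin n → ℝ) : Prop :=
  IsDAlloc likes x ∧
    ∀ x', IsDAlloc likes x' → ∑ o, ∑ j, x' o j ≤ ∑ o, ∑ j, x o j

/-- A transfer path in a divisible allocation `x` from agent `u` to agent `v`: pairwise
distinct agents `a 0 = u, …, a k = v` (`k ≥ 1`) and items `o 0, …, o (k-1)` with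
`x (o t) (a t) > 0` and agent `a (t+1)` liking `o t`. -/
def DTransferPath {m n : ℕ} (likes : Fin n → Fin m → Prop) (x : Fin m → Fin n → ℝ)
    (u v : Fin n) : Prop :=
  ∃ k : ℕ, 1 ≤ k ∧ ∃ a : Fin (k + 1) → Fin n, Function.Injective a ∧
    a 0 = u ∧ a (Fin.last k) = v ∧
    ∃ o : Fin k → Fin m, ∀ t : Fin k,
      0 < x (o t) (a t.castSucc) ∧ likes (a t.succ) (o t)

/-- `x` admits a narrowing transfer: a transfer path from `u` to `v` with `h_u > h_v`. -/
def DNarrowing {m n : ℕ} (likes : Fin n → Fin m → Prop) (x : Fin m → Fin n → ℝ) : Prop :=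
  ∃ u v, DTransferPath likes x u v ∧ dprof x v < dprof x u

/-- A stable divisible allocation: max-USW and admitting no narrowing transfer. -/
def DStable {m n : ℕ} (likes : Fin n → Fin m → Prop) (x : Fin m → Fin n → ℝ) : Prop :=
  DMaxUSW likes x ∧ ¬ DNarrowing likes x

/-- The profile of `x` sorted in ascending order. -/
noncomputable def sortedDProf {m n : ℕ} (x : Fin m → Fin n → ℝ) : Fin n → ℝ :=
  dprof x ∘ Tuple.sort (dprof x)

/-- In a max-USW divisible allocation every item that some agent likes is fully allocated. -/
theorem DMaxUSW.sum_eq_one {m n : ℕ} {likes : Fin n → Fin m → Prop}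
    {x : Fin m → Fin n → ℝ} (hx : DMaxUSW likes x) {o : Fin m} {j : Fin n}
    (hl : likes j o) : ∑ k, x o k = 1 := by
  obtain ⟨⟨hnn, hz, hle⟩, hmax⟩ := hx
  set c : ℝ := 1 - ∑ k, x o k with hc
  have hc0 : 0 ≤ c := sub_nonneg.2 (hle o)
  have hrow : ∀ p, ∑ q, (x p q + if p = o ∧ q = j then c else 0) =
      (∑ q, x p q) + if p = o then c else 0 := by
    intro p
    rw [sum_add_distrib]
    by_cases hp : p = o <;> simp [hp]
  have h := hmax (fun p q => x p q + if p = o ∧ q = j then c else 0) ⟨?_, ?_, ?_⟩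
  · simp only [hrow, sum_add_distrib, sum_ite_eq', mem_univ, if_true] at h
    linarith [hle o]
  · intro p q
    have := hnn p q
    dsimp only
    split_ifs <;> linarith
  · intro p q hpq
    have hne : ¬ (p = o ∧ q = j) := by
      rintro ⟨rfl, rfl⟩
      exact hpq hl
    simp [hne, hz p q hpq]
  · intro p
    rw [hrow]
    split_ifs with hp
    · subst hp
      linarith
    · linarith [hle p]

/-- A stable divisible allocation gives each item only to agents whose total amount is minimal
among the agents liking that item. -/
theorem DStable.dprof_le {m n : ℕ} {likes : Fin n → Fin m → Prop}
    {x : Fin m → Fin n → ℝ} (hx : DStable likes x) {o : Fin m} {j k : Fin n}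
    (hj : 0 < x o j) (hk : likes k o) : dprof x j ≤ dprof x k := by
  by_contra! hlt
  have hne : j ≠ k := by
    rintro rfl
    exact lt_irrefl _ hlt
  refine hx.2 ⟨j, k, ⟨1, le_rfl, ![j, k], ?_, rfl, rfl, ![o], ?_⟩, hlt⟩
  · intro a b hab
    fin_cases a <;> fin_cases b <;> simp_all
  · intro t
    fin_cases t
    exact ⟨hj, hk⟩

/-- The profile of a stable divisible allocation satisfies the first-order optimality condition
for minimizing the sum of squares over the profiles of max-USW divisible allocations. -/
theorem DStable.sum_dprof_mul_le {m n : ℕ} {likes : Fin n → Fin m → Prop}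
    {x y : Fin m → Fin n → ℝ} (hx : DStable likes x) (hy : DMaxUSW likes y) :
    ∑ j, dprof x j * dprof x j ≤ ∑ j, dprof x j * dprof y j := by
  have hswap : ∀ z : Fin m → Fin n → ℝ,
      ∑ j, dprof x j * dprof z j = ∑ o, ∑ j, dprof x j * z o j := by
    intro z
    rw [sum_comm]
    simp only [dprof, mul_sum]
  rw [hswap x, hswap y]
  refine sum_le_sum fun o _ => ?_
  by_cases hlike : ∃ j, likes j o
  · obtain ⟨i, hi⟩ := hlike
    have hx1 := hx.1.sum_eq_one hi
    have hy1 := hy.sum_eq_one hi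
    calc ∑ j, dprof x j * x o j
        = ∑ j, ∑ k, dprof x j * x o j * y o k := by simp only [← mul_sum, hy1, mul_one]
      _ ≤ ∑ j, ∑ k, dprof x k * y o k * x o j := by
          refine sum_le_sum fun j _ => sum_le_sum fun k _ => ?_
          by_cases hk : likes k o
          · rcases (hx.1.1.1 o j).eq_or_lt with hj | hj
            · simp [← hj]
            · have := mul_le_mul_of_nonneg_right (hx.dprof_le hj hk)
                (mul_nonneg hj.le (hy.1.1 o k))
              linarith
          · simp [hy.1.2.1 o k hk]
      _ = ∑ k, dprof x k * y o k := by
          rw [sum_comm]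
          simp only [← mul_sum, hx1, mul_one]
  · push Not at hlike
    simp [hx.1.1.2.1 o _ (hlike _), hy.1.2.1 o _ (hlike _)]

/-- any two stable divisible allocations have identical profiles
(Chebyshev distance `0`). -/
theorem dstable_profiles_eq {m n : ℕ} (likes : Fin n → Fin m → Prop)
    (x x' : Fin m → Fin n → ℝ) (hx : DStable likes x) (hx' : DStable likes x') :
    ∀ i : Fin n, dprof x i = dprof x' i := by
  have h := hx.sum_dprof_mul_le hx'.1
  have h' := hx'.sum_dprof_mul_le hx.1
  have hsq : ∑ j, (dprof x j - dprof x' j) ^ 2 =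
      (∑ j, dprof x j * dprof x j - ∑ j, dprof x j * dprof x' j) +
        (∑ j, dprof x' j * dprof x' j - ∑ j, dprof x' j * dprof x j) := by
    simp only [← sum_sub_distrib, ← sum_add_distrib]
    exact sum_congr rfl fun j _ => by ring
  have hzero : ∑ j, (dprof x j - dprof x' j) ^ 2 = 0 :=
    le_antisymm (by linarith) (sum_nonneg fun j _ => sq_nonneg _)
  intro i
  have hi := (sum_eq_zero_iff_of_nonneg fun j _ => sq_nonneg _).1 hzero i (mem_univ i)
  exact sub_eq_zero.1 (pow_eq_zero_iff two_ne_zero |>.1 hi)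
end
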